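/- For every interval simple game v on N and every i ∈ N, Ψ_i(v) = Σ_{S : i ∈ S ⊆ N} ((s−1)!(n−s)!/n!)·[C(v,S) − C(v,S∖{i})], where s = |S| and C(v,T) = ∫_{[0,1]^n} (v(1_T, x_{−T}) − v(0_T, x_{−T})) dx for all T ⊆ N. -/

import Mathlib

open MeasureTheory

/-- The unit cube `[0,1]^n`. -/
def cube (n : ℕ) : Set (Fin n → ℝ) := {x | ∀ i, x i ∈ Set.Icc (0 : ℝ) 1}

/-- An interval simple game: a function `[0,1]^n → [0,1]` with `v(0)=0`, `v(1)=1`,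
monotone on the cube. -/
def IsISG (n : ℕ) (v : (Fin n → ℝ) → ℝ) : Prop :=
  v (fun _ => 0) = 0 ∧ v (fun _ => 1) = 1 ∧
  (∀ x ∈ cube n, v x ∈ Set.Icc (0 : ℝ) 1) ∧
  (∀ x ∈ cube n, ∀ y ∈ cube n, (∀ i, x i ≤ y i) → v x ≤ v y)

/-- The Shapley–Shubik index `Ψ` for interval simple games. -/
noncomputable def Psi (n : ℕ) (v : (Fin n → ℝ) → ℝ) (i : Fin n) : ℝ :=
  (1 / (n.factorial : ℝ)) * ∑ π : Equiv.Perm (Fin n),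
    ∫ x in cube n,
      ((v (fun j => if π j < π i then x j else 1) -
        v (fun j => if π j < π i then x j else 0)) -
       (v (fun j => if π j ≤ π i then x j else 1) -
        v (fun j => if π j ≤ π i then x j else 0)))

/-- `C(v,T) = ∫_{[0,1]^n} (v(1_T, x_{−T}) − v(0_T, x_{−T})) dx`. -/
noncomputable def Cfun (n : ℕ) (v : (Fin n → ℝ) → ℝ) (T : Finset (Fin n)) : ℝ :=
  ∫ x in cube n,
    (v (fun i => if i ∈ T then 1 else x i) - v (fun i => if i ∈ T then 0 else x i))

/-- A monotone real function on `ℝⁿ` is almost everywhere measurable. -/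
theorem Monotone.aemeasurable_volume_pi {n : ℕ} {g : (Fin n → ℝ) → ℝ} (hg : Monotone g) :
    AEMeasurable g volume := by
  refine NullMeasurable.aemeasurable ?_
  have h : Measurable (fun x : NullMeasurableSpace (Fin n → ℝ) volume => g x) := by
    refine measurable_of_Ioi fun a => ?_
    have hup : IsUpperSet (g ⁻¹' Set.Ioi a) := fun x y hxy hx =>
      lt_of_lt_of_le (show a < g x from hx) (hg hxy)
    exact hup.ordConnected.nullMeasurableSet
  exact fun s hs => h hs

theorem cube_eq_Icc (n : ℕ) : cube n = Set.Icc 0 1 := by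
  ext x
  simp only [cube, Set.mem_ofPred_eq, Set.mem_Icc, Pi.le_def, Pi.zero_apply, Pi.one_apply,
    forall_and]

/-- Freezing some coordinates of an interval simple game at a constant `c ∈ [0,1]` gives a function
that is integrable on the cube. -/
theorem IsISG.integrableOn_ite {n : ℕ} {v : (Fin n → ℝ) → ℝ} (hv : IsISG n v)
    (p : Fin n → Prop) [DecidablePred p] {c : ℝ} (hc : c ∈ Set.Icc (0 : ℝ) 1) :
    IntegrableOn (fun x => v (fun j => if p j then c else x j)) (cube n) volume := by
  obtain ⟨-, -, hrange, hmono⟩ := hv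
  have hmeas : MeasurableSet (cube n) := by rw [cube_eq_Icc]; exact measurableSet_Icc
  have hmem : ∀ x ∈ cube n, (fun j => if p j then c else x j) ∈ cube n := by
    intro x hx j
    by_cases h : p j
    · simpa [h] using hc
    · simpa [h] using hx j
  have hclamp : ∀ x : Fin n → ℝ, (fun j => max 0 (min 1 (x j))) ∈ cube n := fun x j =>
    ⟨le_max_left _ _, max_le zero_le_one (min_le_left _ _)⟩
  have hg : Monotone fun x : Fin n → ℝ =>
      v (fun j => if p j then c else max 0 (min 1 (x j))) := by
    intro x y hxy
    refine hmono _ (hmem _ (hclamp x)) _ (hmem _ (hclamp y)) fun j => ?_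
    by_cases h : p j
    · simp [h]
    · simpa only [h, if_false] using max_le_max le_rfl (min_le_min le_rfl (hxy j))
  have hint : IntegrableOn (fun x : Fin n → ℝ =>
      v (fun j => if p j then c else max 0 (min 1 (x j)))) (cube n) volume := by
    refine Measure.integrableOn_of_bounded (M := 1) ?_
      hg.aemeasurable_volume_pi.aestronglyMeasurable (ae_of_all _ fun x => ?_)
    · rw [cube_eq_Icc]
      exact isCompact_Icc.measure_lt_top.ne
    · have h := hrange _ (hmem _ (hclamp x))
      rw [Real.norm_eq_abs, abs_le]
      exact ⟨by linarith [h.1], h.2⟩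
  refine hint.congr_fun (fun x hx => ?_) hmeas
  have hx' : ∀ j, max 0 (min 1 (x j)) = x j := fun j => by
    rw [min_eq_right (hx j).2, max_eq_right (hx j).1]
  simp only [hx']

/-- The number of permutations that place the elements of `S` last, after those of `Sᶜ`. -/
theorem card_perm_last {n : ℕ} (S : Finset (Fin n)) :
    (Finset.univ.filter fun π : Equiv.Perm (Fin n) => ∀ j, j ∉ S ↔ (π j : ℕ) < n - S.card).card =
      S.card.factorial * (n - S.card).factorial := by
  have hle : S.card ≤ n := by simpa using S.card_le_univ
  have h := Numbering.card_prefixed Sᶜ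
  rw [Finset.card_compl, Fintype.card_fin, Nat.sub_sub_self hle, mul_comm] at h
  rw [← h]
  refine Finset.card_equiv (Equiv.equivCongr (Equiv.refl _)
    (finCongr (Fintype.card_fin n).symm)) fun π => ?_
  simp [Numbering.IsPrefix, Finset.card_compl]

/-- The elements weakly after `i` are exactly those of `S` iff `S` comes last and starts
with `i`. -/
theorem perm_upper_iff {n : ℕ} {S : Finset (Fin n)} {i : Fin n}
    (π : Equiv.Perm (Fin n)) :
    (∀ j, j ∈ S ↔ π i ≤ π j) ↔
      (∀ j, j ∉ S ↔ (π j : ℕ) < n - S.card) ∧ (π i : ℕ) = n - S.card := by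
  constructor
  · intro h
    have hS : S.map π.toEmbedding = Finset.Ici (π i) := by
      ext k
      simp only [Finset.mem_map_equiv, h, Equiv.apply_symm_apply, Finset.mem_Ici]
    have hcard := congrArg Finset.card hS
    rw [Finset.card_map, Fin.card_Ici] at hcard
    have hlt := (π i).isLt
    have hpi : (π i : ℕ) = n - S.card := by omega
    refine ⟨fun j => ?_, hpi⟩
    rw [h j, not_le, Fin.lt_def, hpi]
  · rintro ⟨h, hpi⟩ j
    rw [Fin.le_def, hpi, ← not_lt, ← h j, not_not]

/-- The number of permutations for which the elements weakly after `i` are exactly those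
of `S`. -/
theorem card_perm_upper {n : ℕ} {S : Finset (Fin n)} {i : Fin n} (hi : i ∈ S) :
    (Finset.univ.filter fun π : Equiv.Perm (Fin n) => ∀ j, j ∈ S ↔ π i ≤ π j).card =
      (S.card - 1).factorial * (n - S.card).factorial := by
  classical
  have hle : S.card ≤ n := by simpa using S.card_le_univ
  have hpos : 0 < S.card := Finset.card_pos.2 ⟨i, hi⟩
  have hlt : n - S.card < n := by omega
  have hfib := Finset.card_eq_sum_card_fiberwise
    (s := Finset.univ.filter fun π : Equiv.Perm (Fin n) => ∀ j, j ∉ S ↔ (π j : ℕ) < n - S.card)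
    (t := S) (f := fun π => π.symm ⟨n - S.card, hlt⟩) (by
      intro π hπ
      have hπ' : ∀ j, j ∉ S ↔ (π j : ℕ) < n - S.card := by simpa using hπ
      have := hπ' (π.symm ⟨n - S.card, hlt⟩)
      simpa using this)
  have hconst : ∀ k ∈ S, (Finset.filter (fun π : Equiv.Perm (Fin n) =>
      π.symm ⟨n - S.card, hlt⟩ = k) (Finset.univ.filter fun π : Equiv.Perm (Fin n) =>
        ∀ j, j ∉ S ↔ (π j : ℕ) < n - S.card)).card =
      (Finset.univ.filter fun π : Equiv.Perm (Fin n) => ∀ j, j ∈ S ↔ π i ≤ π j).card := by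
    intro k hk
    refine Finset.card_equiv (Equiv.mulRight (Equiv.swap i k)) fun π => ?_
    have hmem : ∀ j, Equiv.swap i k j ∈ S ↔ j ∈ S := by
      intro j
      rcases eq_or_ne j i with rfl | hji
      · simp [hi, hk]
      rcases eq_or_ne j k with rfl | hjk
      · simp [hi, hk]
      rw [Equiv.swap_apply_of_ne_of_ne hji hjk]
    have hshift : (∀ j, j ∈ S ↔ π k ≤ π (Equiv.swap i k j)) ↔ ∀ j, j ∈ S ↔ π k ≤ π j := by
      rw [← (Equiv.swap i k).forall_congr_right (q := fun j => j ∈ S ↔ π k ≤ π j)]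
      simp only [hmem]
    have hsymm : π.symm ⟨n - S.card, hlt⟩ = k ↔ (π k : ℕ) = n - S.card := by
      rw [Equiv.symm_apply_eq, Fin.ext_iff, eq_comm]
    simp only [Finset.mem_filter, Finset.mem_univ, true_and, Equiv.coe_mulRight,
      Equiv.Perm.mul_apply, Equiv.swap_apply_left]
    rw [hshift, perm_upper_iff, hsymm]
  rw [card_perm_last, Finset.sum_congr rfl hconst, Finset.sum_const, smul_eq_mul,
    ← Nat.mul_factorial_pred hpos.ne', mul_assoc] at hfib
  exact (Nat.eq_of_mul_eq_mul_left hpos hfib).symm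

/-- The contribution of a permutation to `Psi` is a difference of two values of `Cfun`. -/
theorem IsISG.integral_perm_eq {n : ℕ} {v : (Fin n → ℝ) → ℝ} (hv : IsISG n v) {i : Fin n}
    {S : Finset (Fin n)} {π : Equiv.Perm (Fin n)} (h : ∀ j, j ∈ S ↔ π i ≤ π j) :
    ∫ x in cube n,
      ((v (fun j => if π j < π i then x j else 1) -
        v (fun j => if π j < π i then x j else 0)) -
       (v (fun j => if π j ≤ π i then x j else 1) -
        v (fun j => if π j ≤ π i then x j else 0))) = Cfun n v S - Cfun n v (S.erase i) := by
  have hS : ∀ (j : Fin n) (a b : ℝ), (if π j < π i then a else b) = if j ∈ S then b else a := by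
    intro j a b
    simp only [h j, ← not_lt, ite_not]
  have hE : ∀ (j : Fin n) (a b : ℝ),
      (if π j ≤ π i then a else b) = if j ∈ S.erase i then b else a := by
    intro j a b
    have : j ∈ S.erase i ↔ ¬ π j ≤ π i := by
      rw [Finset.mem_erase, h j, not_le, lt_iff_le_and_ne, and_comm, ne_comm,
        π.injective.ne_iff]
    simp only [this, ite_not]
  simp only [hS, hE]
  have h0 : (0 : ℝ) ∈ Set.Icc (0 : ℝ) 1 := by simp
  have h1 : (1 : ℝ) ∈ Set.Icc (0 : ℝ) 1 := by simp
  exact integral_sub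
    ((hv.integrableOn_ite (· ∈ S) h1).sub (hv.integrableOn_ite (· ∈ S) h0))
    ((hv.integrableOn_ite (· ∈ S.erase i) h1).sub (hv.integrableOn_ite (· ∈ S.erase i) h0))

/-- For every interval simple game `v` and player `i`,
`Ψ_i(v) = Σ_{S ∋ i} ((s−1)!(n−s)!/n!)·(C(v,S) − C(v,S∖{i}))`. -/
theorem Psi_eq_C_formula (n : ℕ) (hn : 1 ≤ n) (v : (Fin n → ℝ) → ℝ) (hv : IsISG n v)
    (i : Fin n) :
    Psi n v i =
      ∑ S ∈ Finset.univ.powerset.filter (fun S : Finset (Fin n) => i ∈ S),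
        (((S.card - 1).factorial * (n - S.card).factorial : ℕ) : ℝ) / (n.factorial : ℝ) *
          (Cfun n v S - Cfun n v (S.erase i)) := by
  classical
  rw [Psi, ← Finset.sum_fiberwise_of_maps_to
    (t := Finset.univ.powerset.filter (fun S : Finset (Fin n) => i ∈ S))
    (g := fun π : Equiv.Perm (Fin n) => Finset.univ.filter fun j => π i ≤ π j)
    (fun π _ => by simp), Finset.mul_sum]
  refine Finset.sum_congr rfl fun S hS => ?_
  have hi : i ∈ S := (Finset.mem_filter.1 hS).2
  have hfilter : (Finset.univ.filter fun π : Equiv.Perm (Fin n) =>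
      (Finset.univ.filter fun j => π i ≤ π j) = S) =
      Finset.univ.filter fun π : Equiv.Perm (Fin n) => ∀ j, j ∈ S ↔ π i ≤ π j := by
    ext π
    simp [Finset.ext_iff, iff_comm]
  rw [hfilter, Finset.sum_congr rfl fun π hπ =>
    hv.integral_perm_eq (Finset.mem_filter.1 hπ).2, Finset.sum_const, card_perm_upper hi,
    nsmul_eq_mul]
  ring
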